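/- arXiv:1612.08865 — 2 statements merged into one kernel-verified Lean document; each statement's English description precedes it below -/
import Mathlib

section
/- For every fixed real p > 1, the function σ ↦ τ(p,σ) is strictly monotonically decreasing on the interval [1, σ_p], with boundary values τ(p,1) = τ_p and τ(p,σ_p) = 0. -/
/-- `σ_p = (2^p - 1)^{1/p}`. -/
noncomputable def sigmaP (p : ℝ) : ℝ := (2 ^ p - 1) ^ (1 / p)

/-- `A = A(p,σ,τ) = (1 + τ^p)^{-1/p} - (1 + σ^p)^{-1/p}`. -/
noncomputable def Acoef (p σ τ : ℝ) : ℝ := (1 + τ ^ p) ^ (-1 / p) - (1 + σ ^ p) ^ (-1 / p)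

/-- `B = B(p,σ,τ) = σ (1 + σ^p)^{-1/p} + τ (1 + τ^p)^{-1/p}`. -/
noncomputable def Bcoef (p σ τ : ℝ) : ℝ :=
  σ * (1 + σ ^ p) ^ (-1 / p) + τ * (1 + τ ^ p) ^ (-1 / p)

/-- Increments of a strictly convex power are strictly increasing. -/
lemma rpow_add_add_rpow_lt {p a b d : ℝ} (hp : 1 < p) (ha : 0 ≤ a) (hab : a < b) (hd : 0 < d) :
    (a + d) ^ p + b ^ p < (b + d) ^ p + a ^ p := by
  have hconv := strictConvexOn_rpow hp
  have hL : 0 < b + d - a := by linarith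
  have hne : a ≠ b + d := by linarith
  have hbd : b + d ∈ Set.Ici (0 : ℝ) := Set.mem_Ici.2 (by linarith)
  have hsum : (b - a) / (b + d - a) + d / (b + d - a) = 1 := by field_simp; ring
  have hα : 0 < (b - a) / (b + d - a) := div_pos (by linarith) hL
  have hβ : 0 < d / (b + d - a) := div_pos hd hL
  have h₁ := hconv.2 (Set.mem_Ici.2 ha) hbd hne hα hβ hsum
  have h₂ := hconv.2 (Set.mem_Ici.2 ha) hbd hne hβ hα (by rw [add_comm]; exact hsum)
  simp only [smul_eq_mul] at h₁ h₂
  have e₁ : (b - a) / (b + d - a) * a + d / (b + d - a) * (b + d) = a + d := by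
    field_simp; ring
  have e₂ : d / (b + d - a) * a + (b - a) / (b + d - a) * (b + d) = b := by
    field_simp; ring
  rw [e₁] at h₁
  rw [e₂] at h₂
  calc (a + d) ^ p + b ^ p
      < ((b - a) / (b + d - a) + d / (b + d - a)) * (a ^ p + (b + d) ^ p) := by linarith
    _ = (b + d) ^ p + a ^ p := by rw [hsum]; ring

/-- The abscissa of the point of slope `s` on the unit `ℓ^p` curve is positive. -/
lemma abscissa_pos (p : ℝ) {s : ℝ} (hs : 0 ≤ s) : 0 < (1 + s ^ p) ^ (-1 / p) := by
  have := Real.rpow_nonneg hs p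
  positivity

/-- The `p`-th power of the abscissa of the point of slope `s` on the unit `ℓ^p` curve. -/
lemma abscissa_rpow {p s : ℝ} (hp : 1 < p) (hs : 0 ≤ s) :
    ((1 + s ^ p) ^ (-1 / p)) ^ p = (1 + s ^ p)⁻¹ := by
  have := Real.rpow_nonneg hs p
  rw [← Real.rpow_mul (by positivity), div_mul_cancel₀ _ (by linarith : p ≠ 0), Real.rpow_neg_one]

/-- The point of slope `s` with abscissa `(1 + s ^ p) ^ (-1 / p)` is on the unit `ℓ^p` curve. -/
lemma abscissa_rpow_add_ordinate_rpow {p s : ℝ} (hp : 1 < p) (hs : 0 ≤ s) :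
    ((1 + s ^ p) ^ (-1 / p)) ^ p + (s * (1 + s ^ p) ^ (-1 / p)) ^ p = 1 := by
  have := Real.rpow_nonneg hs p
  rw [Real.mul_rpow hs (abscissa_pos p hs).le, abscissa_rpow hp hs]
  field_simp

lemma abscissa_lt {p s t : ℝ} (hp : 1 < p) (hs : 0 ≤ s) (hst : s < t) :
    (1 + t ^ p) ^ (-1 / p) < (1 + s ^ p) ^ (-1 / p) := by
  have := Real.rpow_nonneg hs p
  have := Real.rpow_lt_rpow hs hst (by linarith : 0 < p)
  exact Real.rpow_lt_rpow_of_neg (by positivity) (by linarith)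
    (div_neg_of_neg_of_pos (by norm_num) (by linarith))

lemma ordinate_lt {p s t : ℝ} (hp : 1 < p) (hs : 0 ≤ s) (hst : s < t) :
    s * (1 + s ^ p) ^ (-1 / p) < t * (1 + t ^ p) ^ (-1 / p) := by
  have ht : 0 ≤ t := hs.trans hst.le
  have h := Real.rpow_lt_rpow (abscissa_pos p ht).le (abscissa_lt hp hs hst)
    (by linarith : 0 < p)
  have h₁ := abscissa_rpow_add_ordinate_rpow hp hs
  have h₂ := abscissa_rpow_add_ordinate_rpow hp ht
  refine lt_of_not_ge fun hle => ?_
  have := Real.rpow_le_rpow (mul_nonneg ht (abscissa_pos p ht).le) hle (by linarith : 0 ≤ p)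
  linarith

lemma Acoef_rpow_add_Bcoef_rpow_lt_of_sigma_lt {p σ₁ σ₂ τ : ℝ} (hp : 1 < p) (hτ : 0 ≤ τ)
    (hτσ : τ < σ₁) (hσ : σ₁ < σ₂) :
    Acoef p σ₁ τ ^ p + Bcoef p σ₁ τ ^ p < Acoef p σ₂ τ ^ p + Bcoef p σ₂ τ ^ p := by
  have hσ₁ : 0 ≤ σ₁ := hτ.trans hτσ.le
  have hA := abscissa_lt hp hτ hτσ
  have hA' := abscissa_lt hp hσ₁ hσ
  have hB := ordinate_lt hp hσ₁ hσ
  have h₁ := mul_nonneg hσ₁ (abscissa_pos p hσ₁).le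
  have h₂ := mul_nonneg hτ (abscissa_pos p hτ).le
  unfold Acoef Bcoef
  exact add_lt_add
    (Real.rpow_lt_rpow (by linarith) (by linarith) (by linarith))
    (Real.rpow_lt_rpow (by linarith) (by linarith) (by linarith))

lemma Acoef_rpow_add_Bcoef_rpow_lt_of_tau_lt {p σ τ₁ τ₂ : ℝ} (hp : 1 < p) (hτ₁ : 0 ≤ τ₁)
    (hτ : τ₁ < τ₂) (hτσ : τ₂ < σ) :
    Acoef p σ τ₁ ^ p + Bcoef p σ τ₁ ^ p < Acoef p σ τ₂ ^ p + Bcoef p σ τ₂ ^ p := by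
  have hτ₂ : 0 ≤ τ₂ := hτ₁.trans hτ.le
  have hσ : 0 < σ := hτ₂.trans_lt hτσ
  have e₁ := abscissa_rpow_add_ordinate_rpow hp hτ₁
  have e₂ := abscissa_rpow_add_ordinate_rpow hp hτ₂
  have hv := abscissa_lt hp hτ₁ hτ
  have hu := abscissa_lt hp hτ₂ hτσ
  have hw := ordinate_lt hp hτ₁ hτ
  have hu₀ := abscissa_pos p hσ.le
  have hw₁ := mul_nonneg hτ₁ (abscissa_pos p hτ₁).le
  unfold Acoef Bcoef
  set u := (1 + σ ^ p) ^ (-1 / p)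
  set v₁ := (1 + τ₁ ^ p) ^ (-1 / p)
  set v₂ := (1 + τ₂ ^ p) ^ (-1 / p)
  have hA := rpow_add_add_rpow_lt hp (a := v₂ - u) (b := v₁ - u) (by linarith) (by linarith) hu₀
  have hB := rpow_add_add_rpow_lt hp hw₁ hw (mul_pos hσ hu₀)
  rw [sub_add_cancel, sub_add_cancel] at hA
  rw [add_comm (σ * u), add_comm (σ * u)]
  linarith

lemma eq_of_Acoef_rpow_add_Bcoef_rpow_eq {p σ τ₁ τ₂ : ℝ} (hp : 1 < p) (hτ₁ : 0 ≤ τ₁)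
    (hτ₂ : 0 ≤ τ₂) (hτσ₁ : τ₁ < σ) (hτσ₂ : τ₂ < σ)
    (h : Acoef p σ τ₁ ^ p + Bcoef p σ τ₁ ^ p = Acoef p σ τ₂ ^ p + Bcoef p σ τ₂ ^ p) :
    τ₁ = τ₂ := by
  rcases lt_trichotomy τ₁ τ₂ with hlt | heq | hgt
  · exact absurd h (Acoef_rpow_add_Bcoef_rpow_lt_of_tau_lt hp hτ₁ hlt hτσ₂).ne
  · exact heq
  · exact absurd h (Acoef_rpow_add_Bcoef_rpow_lt_of_tau_lt hp hτ₂ hgt hτσ₁).ne'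

lemma Acoef_rpow_add_Bcoef_rpow_one {p τ : ℝ} (hp : 1 < p) (hτ : 0 ≤ τ) (hτ' : τ < 1)
    (h : 2 * (1 - τ) ^ p = 1 + τ ^ p) : Acoef p 1 τ ^ p + Bcoef p 1 τ ^ p = 1 := by
  have h₁ : 0 < 1 - τ := by linarith
  have hv : (1 + τ ^ p) ^ (-1 / p) * (1 - τ) = (2 : ℝ) ^ (-1 / p) := by
    rw [← h, Real.mul_rpow (by norm_num) (by positivity), ← Real.rpow_mul h₁.le,
      mul_div_cancel₀ _ (by linarith : p ≠ 0), Real.rpow_neg_one, mul_assoc,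
      inv_mul_cancel₀ h₁.ne', mul_one]
  have hu : ((1 : ℝ) + 1 ^ p) ^ (-1 / p) = (1 + τ ^ p) ^ (-1 / p) * (1 - τ) := by
    rw [hv, Real.one_rpow]; norm_num
  have hA : Acoef p 1 τ = τ * (1 + τ ^ p) ^ (-1 / p) := by
    unfold Acoef; rw [hu]; ring
  have hB : Bcoef p 1 τ = (1 + τ ^ p) ^ (-1 / p) := by
    unfold Bcoef; rw [hu]; ring
  rw [hA, hB, add_comm]
  exact abscissa_rpow_add_ordinate_rpow hp hτ

lemma one_le_two_rpow_sub_one {p : ℝ} (hp : 1 < p) : (1 : ℝ) ≤ 2 ^ p - 1 := by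
  have := Real.rpow_le_rpow_of_exponent_le (x := 2) (by norm_num) hp.le
  rw [Real.rpow_one] at this
  linarith

lemma one_le_sigmaP {p : ℝ} (hp : 1 < p) : 1 ≤ sigmaP p :=
  Real.one_le_rpow (one_le_two_rpow_sub_one hp) (by positivity)

lemma Acoef_rpow_add_Bcoef_rpow_sigmaP {p : ℝ} (hp : 1 < p) :
    Acoef p (sigmaP p) 0 ^ p + Bcoef p (sigmaP p) 0 ^ p = 1 := by
  have hp₀ : p ≠ 0 := by linarith
  have hσ : sigmaP p ^ p = 2 ^ p - 1 := by
    unfold sigmaP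
    rw [← Real.rpow_mul (by linarith [one_le_two_rpow_sub_one hp]), one_div_mul_cancel hp₀,
      Real.rpow_one]
  have hu : (1 + sigmaP p ^ p) ^ (-1 / p) = 1 / 2 := by
    rw [hσ, add_sub_cancel, ← Real.rpow_mul (by norm_num), mul_div_cancel₀ _ hp₀,
      Real.rpow_neg_one, one_div]
  have hσ₀ : 0 ≤ sigmaP p := zero_le_one.trans (one_le_sigmaP hp)
  have hA : Acoef p (sigmaP p) 0 = (1 + sigmaP p ^ p) ^ (-1 / p) := by
    unfold Acoef
    rw [hu, Real.zero_rpow hp₀, add_zero, Real.one_rpow]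
    norm_num
  have hB : Bcoef p (sigmaP p) 0 = sigmaP p * (1 + sigmaP p ^ p) ^ (-1 / p) := by
    unfold Bcoef; rw [zero_mul, add_zero]
  rw [hA, hB]
  exact abscissa_rpow_add_ordinate_rpow hp hσ₀

/-- For every fixed real `p > 1`, the implicit function `σ ↦ τ(p,σ)` is
strictly monotonically decreasing on `[1, σ_p]`, with `τ(p,1) = τ_p` and `τ(p,σ_p) = 0`. -/
theorem stmt_4 (p : ℝ) (hp : 1 < p) (τp : ℝ)
    (hτp : 0 ≤ τp ∧ τp < 1 ∧ 2 * (1 - τp) ^ p = 1 + τp ^ p)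
    (T : ℝ → ℝ)
    (hT : ∀ σ ∈ Set.Icc 1 (sigmaP p),
      0 ≤ T σ ∧ T σ ≤ τp ∧ Acoef p σ (T σ) ^ p + Bcoef p σ (T σ) ^ p = 1) :
    StrictAntiOn T (Set.Icc 1 (sigmaP p)) ∧ T 1 = τp ∧ T (sigmaP p) = 0 := by
  obtain ⟨hτ₀, hτ₁, hτeq⟩ := hτp
  have hσp := one_le_sigmaP hp
  refine ⟨fun σ₁ h₁ σ₂ h₂ hlt => ?_, ?_, ?_⟩
  · obtain ⟨hn₁, hle₁, e₁⟩ := hT σ₁ h₁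
    obtain ⟨hn₂, hle₂, e₂⟩ := hT σ₂ h₂
    have hσ := Acoef_rpow_add_Bcoef_rpow_lt_of_sigma_lt hp hn₁ (by linarith [h₁.1]) hlt
    refine lt_of_not_ge fun hge => ?_
    rcases hge.eq_or_lt with heq | hτ
    · rw [← heq] at e₂
      linarith
    · have := Acoef_rpow_add_Bcoef_rpow_lt_of_tau_lt hp hn₁ hτ
        (show T σ₂ < σ₂ by linarith [h₂.1])
      linarith
  · obtain ⟨hn, hle, e⟩ := hT 1 ⟨le_rfl, hσp⟩
    exact eq_of_Acoef_rpow_add_Bcoef_rpow_eq hp hn hτ₀ (by linarith) hτ₁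
      (e.trans (Acoef_rpow_add_Bcoef_rpow_one hp hτ₀ hτ₁ hτeq).symm)
  · obtain ⟨hn, hle, e⟩ := hT (sigmaP p) ⟨hσp, le_rfl⟩
    exact eq_of_Acoef_rpow_add_Bcoef_rpow_eq hp hn le_rfl (by linarith) (by linarith)
      (e.trans (Acoef_rpow_add_Bcoef_rpow_sigmaP hp).symm)
end

section
/- For every real p > 1, g(p,1) = g(p,σ_p) = 0, where g(p,σ) = -(1 + σ^p)^{1 + 1/p}(B(p,σ)^{p-1} - τ(p,σ)^{p-1} A(p,σ)^{p-1}) ∂Δ(p,σ)/∂σ. -/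
/-- Given the branch `T : σ ↦ τ(p,σ)`, the Minkowski–Cohn function
`Δ(p,σ) = (τ(p,σ) + σ)(1 + τ(p,σ)^p)^{-1/p}(1 + σ^p)^{-1/p}`. -/
noncomputable def DeltaFun (p : ℝ) (T : ℝ → ℝ) (σ : ℝ) : ℝ :=
  (T σ + σ) * (1 + T σ ^ p) ^ (-1 / p) * (1 + σ ^ p) ^ (-1 / p)

/-- Given the branch `T : σ ↦ τ(p,σ)`, the function
`g(p,σ) = -(1 + σ^p)^{1 + 1/p} (B^{p-1} - τ^{p-1} A^{p-1}) ∂Δ(p,σ)/∂σ`. -/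
noncomputable def gFun (p : ℝ) (T : ℝ → ℝ) (σ : ℝ) : ℝ :=
  -(1 + σ ^ p) ^ (1 + 1 / p) *
    (Bcoef p σ (T σ) ^ (p - 1) - T σ ^ (p - 1) * Acoef p σ (T σ) ^ (p - 1)) *
    derivWithin (DeltaFun p T) (Set.Icc 1 (sigmaP p)) σ

open Set Filter Topology

/-- If `F (x, T x)` is constant on `s`, `T` is continuous at `x₀` within `s`, and `∂F/∂y ≠ 0`,
then `T` is differentiable at `x₀` within `s`, with derivative `-F_x / F_y`. -/
theorem hasDerivWithinAt_of_implicit {F : ℝ × ℝ → ℝ} {T : ℝ → ℝ} {s : Set ℝ} {x₀ a b c : ℝ}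
    (hF : HasFDerivAt F (a • ContinuousLinearMap.fst ℝ ℝ ℝ + b • ContinuousLinearMap.snd ℝ ℝ ℝ)
      (x₀, T x₀))
    (hb : b ≠ 0) (hx₀ : x₀ ∈ s) (hT : ContinuousWithinAt T s x₀)
    (hc : ∀ x ∈ s, F (x, T x) = c) :
    HasDerivWithinAt T (-a / b) s x₀ := by
  have htend : Tendsto (fun x => (x, T x)) (𝓝[s] x₀) (𝓝 (x₀, T x₀)) :=
    (tendsto_id.mono_left nhdsWithin_le_nhds).prodMk_nhds hT
  have hlin := hF.isLittleO.comp_tendsto htend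
  rw [hasDerivWithinAt_iff_isLittleO, Asymptotics.isLittleO_iff]
  intro ε hε
  set K : ℝ := |a / b| + 1 with hK
  have hKpos : 0 < K := by positivity
  have hbpos : 0 < |b| := abs_pos.mpr hb
  obtain ⟨δ, hδ, hδ1, hδ2⟩ : ∃ δ : ℝ, 0 < δ ∧ δ ≤ 1 / 2 ∧ 2 * K * δ ≤ ε := by
    refine ⟨min (1 / 2) (ε / (2 * K)), by positivity, min_le_left _ _, ?_⟩
    calc 2 * K * min (1 / 2) (ε / (2 * K)) ≤ 2 * K * (ε / (2 * K)) := by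
          gcongr; exact min_le_right _ _
      _ = ε := by field_simp
  have hev := (Asymptotics.isLittleO_iff.mp hlin) (mul_pos hδ hbpos)
  filter_upwards [hev, self_mem_nhdsWithin] with x hx hxs
  simp only [Function.comp_apply, hc x hxs, hc x₀ hx₀, sub_self, zero_sub, norm_neg,
    Prod.mk_sub_mk, add_apply, smul_apply,
    ContinuousLinearMap.coe_fst', ContinuousLinearMap.coe_snd', smul_eq_mul,
    Prod.norm_mk, Real.norm_eq_abs] at hx
  simp only [smul_eq_mul, Real.norm_eq_abs]
  set h := x - x₀
  set t := T x - T x₀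
  have e1 : a * h + b * t = b * (t - h * (-a / b)) := by field_simp; ring
  rw [e1, abs_mul] at hx
  set r := t - h * (-a / b) with hr
  have hr1 : |r| ≤ δ * max |h| |t| := by
    have : |b| * |r| ≤ |b| * (δ * max |h| |t|) := by linarith
    exact le_of_mul_le_mul_left this hbpos
  have ht : |t| ≤ |r| + |a / b| * |h| := by
    have : t = r + -(a / b * h) := by rw [hr]; ring
    calc |t| = |r + -(a / b * h)| := by rw [← this]
      _ ≤ |r| + |-(a / b * h)| := abs_add_le _ _
      _ = _ := by rw [abs_neg, abs_mul]
  have hmax : max |h| |t| ≤ |r| + K * |h| := by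
    have h0 := abs_nonneg h
    have h1 := abs_nonneg r
    have h2 := mul_nonneg (abs_nonneg (a / b)) h0
    apply max_le <;> rw [hK] <;> nlinarith
  have h3 : |r| ≤ δ * (|r| + K * |h|) := hr1.trans (by gcongr)
  have h4 : δ * |r| ≤ 1 / 2 * |r| := by gcongr
  have h5 : 2 * K * δ * |h| ≤ ε * |h| := by gcongr
  nlinarith

/-- A map into a compact set on a level set of a continuous function is continuous at any point
at which the level equation has a unique solution. -/
theorem continuousWithinAt_of_implicit {F : ℝ × ℝ → ℝ} {T : ℝ → ℝ} {s K : Set ℝ} {x₀ c : ℝ}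
    (hK : IsCompact K) (hTK : ∀ x ∈ s, T x ∈ K)
    (hF : ∀ y ∈ K, ContinuousAt F (x₀, y)) (hc : ∀ x ∈ s, F (x, T x) = c)
    (huniq : ∀ y ∈ K, F (x₀, y) = c → y = T x₀) :
    ContinuousWithinAt T s x₀ := by
  refine hK.tendsto_nhds_of_unique_mapClusterPt
    (by filter_upwards [self_mem_nhdsWithin] with x hx using hTK x hx) fun y hy hcl => ?_
  obtain ⟨U, hU, hUy⟩ := mapClusterPt_iff_ultrafilter.mp hcl
  refine huniq y hy ?_
  have hpair : Tendsto (fun x => (x, T x)) U (𝓝 (x₀, y)) :=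
    (tendsto_id.mono_left (hU.trans nhdsWithin_le_nhds)).prodMk_nhds hUy
  have hlim := (hF y hy).tendsto.comp hpair
  have hconst : Tendsto (F ∘ fun x => (x, T x)) U (𝓝 c) := by
    refine tendsto_const_nhds.congr' ?_
    filter_upwards [hU self_mem_nhdsWithin] with x hx using (hc x hx).symm
  exact tendsto_nhds_unique hlim hconst

section Curve

variable {p : ℝ}

theorem one_add_rpow_pos {x : ℝ} (hx : 0 ≤ x) : 0 < 1 + x ^ p := by positivity

theorem hasDerivAt_one_add_rpow (hp : 1 < p) {x : ℝ} (hx : 0 ≤ x) :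
    HasDerivAt (fun y : ℝ => (1 + y ^ p) ^ (-1 / p))
      (-(x ^ (p - 1) * (1 + x ^ p) ^ (-1 / p - 1))) x := by
  have h1 := (Real.hasDerivAt_rpow_const (x := x) (p := p) (Or.inr hp.le)).const_add 1
  refine (h1.rpow_const (p := -1 / p) (Or.inl (one_add_rpow_pos hx).ne')).congr_deriv ?_
  have : p ≠ 0 := by positivity
  field_simp

theorem one_add_rpow_eq {x : ℝ} (hx : 0 ≤ x) :
    (1 + x ^ p) ^ (-1 / p) = (1 + x ^ p) * (1 + x ^ p) ^ (-1 / p - 1) := by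
  rw [Real.rpow_sub_one (one_add_rpow_pos hx).ne']
  have := (one_add_rpow_pos (p := p) hx).ne'
  field_simp

theorem mul_rpow_sub_one (hp : 1 < p) {x : ℝ} (hx : 0 ≤ x) : x * x ^ (p - 1) = x ^ p := by
  rcases hx.eq_or_lt with rfl | hx
  · rw [zero_mul, Real.zero_rpow (by positivity)]
  · rw [Real.rpow_sub_one hx.ne']; field_simp

theorem hasDerivAt_mul_one_add_rpow (hp : 1 < p) {x : ℝ} (hx : 0 ≤ x) :
    HasDerivAt (fun y : ℝ => y * (1 + y ^ p) ^ (-1 / p)) ((1 + x ^ p) ^ (-1 / p - 1)) x := by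
  refine ((hasDerivAt_id' x).mul (hasDerivAt_one_add_rpow hp hx)).congr_deriv ?_
  rw [one_add_rpow_eq hx, ← mul_rpow_sub_one hp hx]
  ring

/-- The point `(1 + x^p)^{-1/p} (1, x)` lies on the unit `p`-sphere. -/
theorem rpow_add_rpow_eq_one (hp : 1 < p) {x : ℝ} (hx : 0 ≤ x) :
    ((1 + x ^ p) ^ (-1 / p)) ^ p + (x * (1 + x ^ p) ^ (-1 / p)) ^ p = 1 := by
  have h := one_add_rpow_pos (p := p) hx
  have hp0 : p ≠ 0 := by positivity
  rw [Real.mul_rpow hx (by positivity), ← Real.rpow_mul h.le, div_mul_cancel₀ _ hp0,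
    Real.rpow_neg_one]
  field_simp

theorem one_add_rpow_lt (hp : 1 < p) {x y : ℝ} (hx : 0 ≤ x) (hxy : x < y) :
    (1 + y ^ p) ^ (-1 / p) < (1 + x ^ p) ^ (-1 / p) := by
  have hp0 : 0 < p := by positivity
  refine Real.rpow_lt_rpow_of_neg (one_add_rpow_pos hx) ?_ (div_neg_of_neg_of_pos (by simp) hp0)
  gcongr

theorem Acoef_pos (hp : 1 < p) {σ τ : ℝ} (hτ : 0 ≤ τ) (h : τ < σ) : 0 < Acoef p σ τ :=
  sub_pos.mpr (one_add_rpow_lt hp hτ h)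

theorem Acoef_le_Bcoef (hp : 1 < p) {σ τ : ℝ} (hσ : 0 < σ) (hτ : 0 ≤ τ) :
    Acoef p σ τ ≤ Bcoef p σ τ := by
  have hp0 : 0 < p := by positivity
  have hle : ∀ x : ℝ, 0 ≤ x → x ^ p ≤ 1 → x ^ p ≤ x := fun x hx hx1 => by
    have : x ≤ 1 := by
      by_contra! h
      exact absurd hx1 (not_le.mpr (Real.one_lt_rpow h hp0))
    simpa using Real.rpow_le_rpow_of_exponent_ge' hx this zero_le_one hp.le
  have hV := rpow_add_rpow_eq_one hp hσ.le
  have h1 : 0 ≤ (1 + σ ^ p) ^ (-1 / p) := by positivity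
  have h2 : 0 ≤ σ * (1 + σ ^ p) ^ (-1 / p) := by positivity
  have h1' := hle _ h1 (by linarith [Real.rpow_nonneg h2 p])
  have h2' := hle _ h2 (by linarith [Real.rpow_nonneg h1 p])
  have h3 : (1 + τ ^ p) ^ (-1 / p) ≤ 1 :=
    Real.rpow_le_one_of_one_le_of_nonpos (by linarith [Real.rpow_nonneg hτ p])
      (div_nonpos_of_nonpos_of_nonneg (by simp) hp0.le)
  have h4 : 0 ≤ τ * (1 + τ ^ p) ^ (-1 / p) := by positivity
  unfold Acoef Bcoef
  linarith

theorem factor_pos (hp : 1 < p) {σ τ : ℝ} (hσ : 1 ≤ σ) (hτ : 0 ≤ τ) (hτ1 : τ < 1) :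
    0 < Bcoef p σ τ ^ (p - 1) - τ ^ (p - 1) * Acoef p σ τ ^ (p - 1) := by
  have hA := Acoef_pos hp hτ (hτ1.trans_le hσ)
  have hAB := Acoef_le_Bcoef hp (zero_lt_one.trans_le hσ) hτ
  rw [← Real.mul_rpow hτ hA.le, sub_pos]
  exact Real.rpow_lt_rpow (by positivity) (by nlinarith) (by linarith)

/-- Differential of `(σ, τ) ↦ A^p + B^p`. -/
theorem hasFDerivAt_Acoef_rpow_add_Bcoef_rpow (hp : 1 < p) {σ τ : ℝ} (hσ : 0 ≤ σ) (hτ : 0 ≤ τ) :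
    HasFDerivAt (fun z : ℝ × ℝ => Acoef p z.1 z.2 ^ p + Bcoef p z.1 z.2 ^ p)
      ((p * (1 + σ ^ p) ^ (-1 / p - 1) *
          (Bcoef p σ τ ^ (p - 1) + σ ^ (p - 1) * Acoef p σ τ ^ (p - 1))) •
          ContinuousLinearMap.fst ℝ ℝ ℝ +
        (p * (1 + τ ^ p) ^ (-1 / p - 1) *
          (Bcoef p σ τ ^ (p - 1) - τ ^ (p - 1) * Acoef p σ τ ^ (p - 1))) •
          ContinuousLinearMap.snd ℝ ℝ ℝ) (σ, τ) := by
  have hfst : HasFDerivAt (Prod.fst : ℝ × ℝ → ℝ) (ContinuousLinearMap.fst ℝ ℝ ℝ) (σ, τ) :=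
    hasFDerivAt_fst
  have hsnd : HasFDerivAt (Prod.snd : ℝ × ℝ → ℝ) (ContinuousLinearMap.snd ℝ ℝ ℝ) (σ, τ) :=
    hasFDerivAt_snd
  have hA := ((hasDerivAt_one_add_rpow hp hτ).comp_hasFDerivAt (σ, τ) hsnd).sub
    ((hasDerivAt_one_add_rpow hp hσ).comp_hasFDerivAt (σ, τ) hfst)
  have hB := ((hasDerivAt_mul_one_add_rpow hp hσ).comp_hasFDerivAt (σ, τ) hfst).add
    ((hasDerivAt_mul_one_add_rpow hp hτ).comp_hasFDerivAt (σ, τ) hsnd)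
  have hA' := HasDerivAt.comp_hasFDerivAt (σ, τ)
    (Real.hasDerivAt_rpow_const (x := Acoef p σ τ) (p := p) (Or.inr hp.le)) hA
  have hB' := HasDerivAt.comp_hasFDerivAt (σ, τ)
    (Real.hasDerivAt_rpow_const (x := Bcoef p σ τ) (p := p) (Or.inr hp.le)) hB
  refine (hA'.add hB').congr_fderiv ?_
  ext <;> simp <;> ring

/-- For fixed `σ ≥ 1`, `τ ↦ A^p + B^p` is injective on `[0, 1)`. -/
theorem injOn_Acoef_rpow_add_Bcoef_rpow (hp : 1 < p) {σ : ℝ} (hσ : 1 ≤ σ) :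
    InjOn (fun τ => Acoef p σ τ ^ p + Bcoef p σ τ ^ p) (Ico 0 1) := by
  have hd : ∀ τ ∈ Ico (0 : ℝ) 1, HasDerivAt (fun τ => Acoef p σ τ ^ p + Bcoef p σ τ ^ p)
      (p * (1 + τ ^ p) ^ (-1 / p - 1) *
        (Bcoef p σ τ ^ (p - 1) - τ ^ (p - 1) * Acoef p σ τ ^ (p - 1))) τ := fun τ hτ => by
    have h := (hasFDerivAt_Acoef_rpow_add_Bcoef_rpow hp (zero_le_one.trans hσ)
      hτ.1).comp_hasDerivAt τ ((hasDerivAt_const τ σ).prodMk (hasDerivAt_id' τ))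
    refine h.congr_deriv ?_
    simp
  refine (strictMonoOn_of_deriv_pos (convex_Ico 0 1)
    (fun τ hτ => (hd τ hτ).continuousAt.continuousWithinAt) fun τ hτ => ?_).injOn
  have hτ' : τ ∈ Ico (0 : ℝ) 1 := interior_subset hτ
  rw [(hd τ hτ').deriv]
  have := factor_pos hp hσ hτ'.1 hτ'.2
  have := one_add_rpow_pos (p := p) hτ'.1
  positivity

/-- The derivative of `Δ` along the branch vanishes where the gradients of `Δ` and of
`A^p + B^p` are parallel. -/
theorem derivWithin_DeltaFun_eq_zero (hp : 1 < p) {T : ℝ → ℝ} {s : Set ℝ} {σ τp : ℝ}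
    (hτp : τp < 1) (hs : UniqueDiffWithinAt ℝ s σ) (hσs : σ ∈ s) (hσ : 1 ≤ σ)
    (hT : ∀ x ∈ s, 0 ≤ T x ∧ T x ≤ τp ∧ Acoef p x (T x) ^ p + Bcoef p x (T x) ^ p = 1)
    (hcrit : ((1 + σ ^ p) ^ (-1 / p) - T σ ^ (p - 1) * (σ * (1 + σ ^ p) ^ (-1 / p))) *
        (Bcoef p σ (T σ) ^ (p - 1) + σ ^ (p - 1) * Acoef p σ (T σ) ^ (p - 1)) =
      ((1 + T σ ^ p) ^ (-1 / p) - σ ^ (p - 1) * (T σ * (1 + T σ ^ p) ^ (-1 / p))) *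
        (Bcoef p σ (T σ) ^ (p - 1) - T σ ^ (p - 1) * Acoef p σ (T σ) ^ (p - 1))) :
    derivWithin (DeltaFun p T) s σ = 0 := by
  have hσ0 : 0 ≤ σ := zero_le_one.trans hσ
  obtain ⟨hτ0, hτle, hτeq⟩ := hT σ hσs
  have hτ1 : T σ < 1 := hτle.trans_lt hτp
  have hcont : ContinuousWithinAt T s σ :=
    continuousWithinAt_of_implicit
      (F := fun z : ℝ × ℝ => Acoef p z.1 z.2 ^ p + Bcoef p z.1 z.2 ^ p)
      (isCompact_Icc (a := 0) (b := τp)) (fun x hx => ⟨(hT x hx).1, (hT x hx).2.1⟩)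
      (fun y hy => (hasFDerivAt_Acoef_rpow_add_Bcoef_rpow hp hσ0 hy.1).continuousAt)
      (fun x hx => (hT x hx).2.2)
      (fun y hy hy1 => injOn_Acoef_rpow_add_Bcoef_rpow hp hσ ⟨hy.1, hy.2.trans_lt hτp⟩
        ⟨hτ0, hτ1⟩ (hy1.trans hτeq.symm))
  have hfac := factor_pos hp hσ hτ0 hτ1
  have hk : 0 < (1 + T σ ^ p) ^ (-1 / p - 1) := Real.rpow_pos_of_pos (one_add_rpow_pos hτ0) _
  have hp0 : 0 < p := by positivity
  have hT' := hasDerivWithinAt_of_implicit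
    (hasFDerivAt_Acoef_rpow_add_Bcoef_rpow hp hσ0 hτ0) (by positivity) hσs hcont
    (fun x hx => (hT x hx).2.2)
  obtain ⟨t, ht, hT'⟩ : ∃ t, (1 + T σ ^ p) ^ (-1 / p - 1) *
        (Bcoef p σ (T σ) ^ (p - 1) - T σ ^ (p - 1) * Acoef p σ (T σ) ^ (p - 1)) * t =
      -((1 + σ ^ p) ^ (-1 / p - 1) *
        (Bcoef p σ (T σ) ^ (p - 1) + σ ^ (p - 1) * Acoef p σ (T σ) ^ (p - 1))) ∧
      HasDerivWithinAt T t s σ := by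
    refine ⟨_, ?_, hT'⟩
    rw [mul_div_assoc', div_eq_iff (by positivity)]
    ring
  have hu := (hasDerivAt_one_add_rpow hp hτ0).comp_hasDerivWithinAt σ hT'
  have hτu := (hasDerivAt_mul_one_add_rpow hp hτ0).comp_hasDerivWithinAt σ hT'
  have hv := (hasDerivAt_one_add_rpow hp hσ0).hasDerivWithinAt (s := s)
  have hσv := (hasDerivAt_mul_one_add_rpow hp hσ0).hasDerivWithinAt (s := s)
  have hD := (hτu.mul hv).add (hu.mul hσv)
  have hD0 : HasDerivWithinAt (DeltaFun p T) 0 s σ := by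
    refine (hD.congr_deriv ?_).congr (fun x _ => ?_) ?_
    · simp only [Function.comp_apply]
      refine mul_left_cancel₀ hfac.ne' ?_
      linear_combination ((1 + σ ^ p) ^ (-1 / p) - T σ ^ (p - 1) * (σ * (1 + σ ^ p) ^ (-1 / p))) *
        ht - (1 + σ ^ p) ^ (-1 / p - 1) * hcrit
    all_goals simp only [DeltaFun, Pi.add_apply, Pi.mul_apply, Function.comp_apply]; ring
  exact hD0.derivWithin hs

end Curve

theorem one_lt_sigmaP {p : ℝ} (hp : 1 < p) : 1 < sigmaP p := by
  have h : (2 : ℝ) ^ (1 : ℝ) < 2 ^ p := Real.rpow_lt_rpow_of_exponent_lt one_lt_two hp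
  rw [Real.rpow_one] at h
  exact Real.one_lt_rpow (by linarith) (by positivity)

theorem one_add_sigmaP_rpow {p : ℝ} (hp : 1 < p) :
    (1 + sigmaP p ^ p) ^ (-1 / p) = 1 / 2 := by
  have h : (1 : ℝ) < 2 ^ p := Real.one_lt_rpow one_lt_two (by positivity)
  have hp0 : p ≠ 0 := by positivity
  rw [sigmaP, ← Real.rpow_mul (by linarith), one_div_mul_cancel hp0, Real.rpow_one,
    add_sub_cancel, ← Real.rpow_mul two_pos.le, mul_div_cancel₀ _ hp0, Real.rpow_neg_one,
    one_div]

/-- For every real `p > 1`, `g(p,1) = g(p,σ_p) = 0`. -/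
theorem stmt_9 (p : ℝ) (hp : 1 < p) (τp : ℝ)
    (hτp : 0 ≤ τp ∧ τp < 1 ∧ 2 * (1 - τp) ^ p = 1 + τp ^ p)
    (T : ℝ → ℝ)
    (hT : ∀ σ ∈ Set.Icc 1 (sigmaP p),
      0 ≤ T σ ∧ T σ ≤ τp ∧ Acoef p σ (T σ) ^ p + Bcoef p σ (T σ) ^ p = 1) :
    gFun p T 1 = 0 ∧ gFun p T (sigmaP p) = 0 := by
  obtain ⟨hτ0, hτ1, hτeq⟩ := hτp
  have hσp := one_lt_sigmaP hp
  have hp0 : p ≠ 0 := by positivity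
  have hmem1 : (1 : ℝ) ∈ Icc 1 (sigmaP p) := ⟨le_rfl, hσp.le⟩
  have hmemσ : sigmaP p ∈ Icc 1 (sigmaP p) := ⟨hσp.le, le_rfl⟩
  have hdiff := uniqueDiffOn_Icc hσp
  constructor
  · have hv : (1 + (1 : ℝ) ^ p) ^ (-1 / p) = (1 - τp) * (1 + τp ^ p) ^ (-1 / p) := by
      have h1 : 0 < 1 - τp := by linarith
      rw [← hτeq, Real.mul_rpow two_pos.le (by positivity), ← Real.rpow_mul h1.le,
        mul_div_cancel₀ _ hp0, Real.rpow_neg_one, Real.one_rpow, one_add_one_eq_two]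
      field_simp
    have hA : Acoef p 1 τp = τp * (1 + τp ^ p) ^ (-1 / p) := by rw [Acoef, hv]; ring
    have hB : Bcoef p 1 τp = (1 + τp ^ p) ^ (-1 / p) := by rw [Bcoef, hv]; ring
    have hT1 : T 1 = τp := by
      obtain ⟨h0, h1, h2⟩ := hT 1 hmem1
      refine injOn_Acoef_rpow_add_Bcoef_rpow hp le_rfl ⟨h0, h1.trans_lt hτ1⟩ ⟨hτ0, hτ1⟩
        (h2.trans ?_)
      beta_reduce
      rw [hA, hB, add_comm, rpow_add_rpow_eq_one hp hτ0]
    rw [gFun, derivWithin_DeltaFun_eq_zero hp hτ1 (hdiff 1 hmem1) hmem1 le_rfl hT, mul_zero]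
    have hu : 0 ≤ (1 + τp ^ p) ^ (-1 / p) := by positivity
    rw [hT1, hA, hB, hv, Real.mul_rpow hτ0 hu, Real.one_rpow]
    ring
  · have hv := one_add_sigmaP_rpow hp
    have hz : (0 : ℝ) ^ p = 0 := Real.zero_rpow hp0
    have hA : Acoef p (sigmaP p) 0 = 1 / 2 := by
      rw [Acoef, hv, hz, add_zero, Real.one_rpow]; norm_num
    have hB : Bcoef p (sigmaP p) 0 = sigmaP p * (1 / 2) := by rw [Bcoef, hv]; ring
    have hTσ : T (sigmaP p) = 0 := by
      obtain ⟨h0, h1, h2⟩ := hT _ hmemσ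
      refine injOn_Acoef_rpow_add_Bcoef_rpow hp hσp.le ⟨h0, h1.trans_lt hτ1⟩
        ⟨le_rfl, one_pos⟩ (h2.trans ?_)
      have h := rpow_add_rpow_eq_one hp (zero_le_one.trans hσp.le)
      rw [hv] at h
      beta_reduce
      rw [hA, hB, h]
    rw [gFun, derivWithin_DeltaFun_eq_zero hp hτ1 (hdiff _ hmemσ) hmemσ hσp.le hT, mul_zero]
    rw [hTσ, hA, hB, hv, hz, Real.zero_rpow (by linarith : p - 1 ≠ 0),
      Real.mul_rpow (by linarith) (by norm_num), add_zero, Real.one_rpow]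
    ring
end
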